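/- arXiv:1811.10075 — 15 statements merged into one kernel-verified Lean document; each statement's English description precedes it below -/
import Mathlib

section
/- Let K be a field with char K ∉ {2,3} and let a, b, c ∈ K. Set P(X) = X³ + aX² + bX + c, D(X) = X³ − bX − 2c and Q(X) = 4cX³ + b²X² + 2bcX + c² in K[X]. Then the resultant with respect to y of the two polynomials x²·P(y) − y²·P(x) and D(y), viewed as polynomials in y with coefficients in K[x], equals ε · c · (x³ − bx − 2c)² · (4cx³ + b²x² + 2bcx + c²) as an element of K[x], for some sign ε ∈ {1, −1}. -/
open Polynomial

/-- The determinant of the Sylvester matrix of a cubic and a depressed monic cubic. -/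
theorem det_sylvester_cubic_depressed {R : Type*} [CommRing R] (f₃ f₂ f₁ f₀ p q : R) :
    (Matrix.of
      ![![f₃, f₂, f₁, f₀, 0, 0],
        ![0, f₃, f₂, f₁, f₀, 0],
        ![0, 0, f₃, f₂, f₁, f₀],
        ![1, 0, p, q, 0, 0],
        ![0, 1, 0, p, q, 0],
        ![0, 0, 1, 0, p, q]]).det =
      f₃ ^ 3 * q ^ 3 - f₃ ^ 2 * f₀ * p ^ 3 + f₃ ^ 2 * f₁ * p ^ 2 * q
        - f₃ ^ 2 * f₂ * p * q ^ 2 - 3 * f₃ ^ 2 * f₀ * q ^ 2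
        + 2 * f₃ * f₁ * f₀ * p ^ 2 - 2 * f₃ * f₁ ^ 2 * p * q + 3 * f₃ * f₂ * f₁ * q ^ 2
        - f₃ * f₂ * f₀ * p * q + 3 * f₃ * f₀ ^ 2 * q
        - f₂ ^ 3 * q ^ 2 + f₂ ^ 2 * f₁ * p * q - f₂ ^ 2 * f₀ * p ^ 2
        - 3 * f₂ * f₁ * f₀ * q + 2 * f₂ * f₀ ^ 2 * p
        + f₁ ^ 3 * q - f₁ ^ 2 * f₀ * p - f₀ ^ 3 := by
  simp [Matrix.det_succ_row_zero, Fin.sum_univ_succ, Fin.succAbove]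
  ring

/-- The resultant with respect to `y` of `x²·P(y) − y²·P(x)` and `D(y)`,
computed as the determinant of their 6×6 Sylvester matrix over `K[x]`, equals
`ε · c · D(x)² · Q(x)` for some sign `ε ∈ {1, −1}`.  Here `P(X) = X³ + aX² + bX + c`,
`D(X) = X³ − bX − 2c` and `Q(X) = 4cX³ + b²X² + 2bcX + c²`, and the first cubic in `y` is
`x²·y³ + (a·x² − P(x))·y² + b·x²·y + c·x²`. -/
theorem stmt_0 (K : Type*) [Field K]
    (hchar2 : ringChar K ≠ 2) (hchar3 : ringChar K ≠ 3)
    (a b c : K)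
    (P D Q : K[X])
    (hP : P = X ^ 3 + C a * X ^ 2 + C b * X + C c)
    (hD : D = X ^ 3 - C b * X - C (2 * c))
    (hQ : Q = C (4 * c) * X ^ 3 + C (b ^ 2) * X ^ 2 + C (2 * b * c) * X + C (c ^ 2))
    -- the coefficients, in `K[x]`, of `x²·P(y) − y²·P(x)` as a cubic in `y`
    (f₃ f₂ f₁ f₀ : K[X])
    (hf₃ : f₃ = X ^ 2) (hf₂ : f₂ = C a * X ^ 2 - P)
    (hf₁ : f₁ = C b * X ^ 2) (hf₀ : f₀ = C c * X ^ 2)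
    -- the coefficients, in `K[x]`, of `D(y)` as a cubic in `y`
    (g₃ g₂ g₁ g₀ : K[X])
    (hg₃ : g₃ = 1) (hg₂ : g₂ = 0) (hg₁ : g₁ = C (-b)) (hg₀ : g₀ = C (-(2 * c)))
    -- the Sylvester matrix of the two cubics
    (S : Matrix (Fin 6) (Fin 6) K[X])
    (hS : S = Matrix.of
      ![![f₃, f₂, f₁, f₀, 0, 0],
        ![0, f₃, f₂, f₁, f₀, 0],
        ![0, 0, f₃, f₂, f₁, f₀],
        ![g₃, g₂, g₁, g₀, 0, 0],
        ![0, g₃, g₂, g₁, g₀, 0],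
        ![0, 0, g₃, g₂, g₁, g₀]]) :
    ∃ ε : K, (ε = 1 ∨ ε = -1) ∧ S.det = C ε * (C c * D ^ 2 * Q) := by
  refine ⟨1, Or.inl rfl, ?_⟩
  subst hS hg₃ hg₂ hg₁ hg₀
  rw [det_sylvester_cubic_depressed]
  subst hf₃ hf₂ hf₁ hf₀ hP hD hQ
  simp only [map_neg, map_mul, map_pow, map_one, map_ofNat]
  ring
end

section
/- Let K be a field with char K ∉ {2,3}, let a, b, c, d ∈ K, and set P(X) = X³ + aX² + bX + c, Q(X) = 4cX³ + b²X² + 2bcX + c², and Δ₁ = a²b² − 4b³ − 4a³c + 18abc − 27c². Suppose x₀, y₀ ∈ K satisfy d·y₀² = P(x₀)·Q(x₀) and P(x₀) ≠ 0. Define u = x₀²/P(x₀) and v = −y₀·(x₀³ − b·x₀ − 2c)/P(x₀)². Then d·v² = Δ₁·u³ + 2(−ab² + 6a²c − 9bc)·u² + (b² − 12ac)·u + 4c. -/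
/-- The generic degree-3 covering `φ₁` maps points of the genus-2 curve
`C : d·y² = P(x)·Q(x)` to points of the elliptic curve `E₁`. -/
theorem stmt_1 (K : Type*) [Field K]
    (hchar2 : ringChar K ≠ 2) (hchar3 : ringChar K ≠ 3)
    (a b c d x₀ y₀ : K)
    (hC : d * y₀ ^ 2 =
      (x₀ ^ 3 + a * x₀ ^ 2 + b * x₀ + c) *
        (4 * c * x₀ ^ 3 + b ^ 2 * x₀ ^ 2 + 2 * b * c * x₀ + c ^ 2))
    (hP : x₀ ^ 3 + a * x₀ ^ 2 + b * x₀ + c ≠ 0)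
    (u v : K)
    (hu : u = x₀ ^ 2 / (x₀ ^ 3 + a * x₀ ^ 2 + b * x₀ + c))
    (hv : v = -y₀ * (x₀ ^ 3 - b * x₀ - 2 * c) /
      (x₀ ^ 3 + a * x₀ ^ 2 + b * x₀ + c) ^ 2) :
    d * v ^ 2 =
      (a ^ 2 * b ^ 2 - 4 * b ^ 3 - 4 * a ^ 3 * c + 18 * a * b * c - 27 * c ^ 2) * u ^ 3 +
        2 * (-(a * b ^ 2) + 6 * a ^ 2 * c - 9 * b * c) * u ^ 2 +
        (b ^ 2 - 12 * a * c) * u + 4 * c := by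
  subst hu hv
  obtain ⟨P, hPx⟩ : ∃ P, P = x₀ ^ 3 + a * x₀ ^ 2 + b * x₀ + c := ⟨_, rfl⟩
  rw [← hPx] at hC hP ⊢
  have hdv : d * (-y₀ * (x₀ ^ 3 - b * x₀ - 2 * c) / P ^ 2) ^ 2 =
      (4 * c * x₀ ^ 3 + b ^ 2 * x₀ ^ 2 + 2 * b * c * x₀ + c ^ 2) *
        (x₀ ^ 3 - b * x₀ - 2 * c) ^ 2 / P ^ 3 := by
    rw [div_pow, ← mul_div_assoc,
      div_eq_div_iff (pow_ne_zero 2 (pow_ne_zero 2 hP)) (pow_ne_zero 3 hP)]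
    linear_combination (x₀ ^ 3 - b * x₀ - 2 * c) ^ 2 * P ^ 3 * hC
  rw [hdv]
  field_simp
  rw [hPx]
  ring
end

section
/- Let K be a field with char K ∉ {2,3}, let a, b, c, d ∈ K, and set P(X) = X³ + aX² + bX + c, Q(X) = 4cX³ + b²X² + 2bcX + c², N(X) = (bX + 3c)²·((b³ − 4abc + 9c²)X + c(b² − 3ac)), and Δ₂ = b³ − 27c². Suppose x₀, y₀ ∈ K satisfy d·y₀² = P(x₀)·Q(x₀), Q(x₀) ≠ 0, and b·x₀ + 3c ≠ 0. Define u = N(x₀)/Q(x₀) and v = y₀·(N′(x₀)·Q(x₀) − N(x₀)·Q′(x₀))/((b·x₀ + 3c)·Q(x₀)²), where N′ and Q′ denote derivatives. Then Δ₂·d·v² = u³ + (ab³ − 27b²c + 54ac²)·u² + (b⁷ − 18ab⁵c + 54a²b³c² + 189b⁴c² − 972ab²c³ + 729a²c⁴ + 729bc⁴)·u − c·(2b³ − 9abc + 27c²)³. -/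
open Polynomial

/-- The polynomial identity behind `φ₂`, with denominators cleared: for `P`, `Q` as in the curve,
`N = L ^ 2 * G` and `M` the Wronskian of `Q` and `N` divided by `L`. -/
theorem covering_identity {R : Type*} [CommRing R] {a b c x e P Q Q' L G M N : R}
    (he : e = b ^ 3 - 4 * a * b * c + 9 * c ^ 2)
    (hP : P = x ^ 3 + a * x ^ 2 + b * x + c)
    (hQ : Q = 4 * c * x ^ 3 + b ^ 2 * x ^ 2 + 2 * b * c * x + c ^ 2)
    (hQ' : Q' = 12 * c * x ^ 2 + 2 * b ^ 2 * x + 2 * b * c)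
    (hL : L = b * x + 3 * c) (hG : G = e * x + c * (b ^ 2 - 3 * a * c))
    (hN : N = L ^ 2 * G) (hM : M = (2 * b * G + L * e) * Q - L * G * Q') :
    (b ^ 3 - 27 * c ^ 2) * (P * M ^ 2) =
      N ^ 3 + (a * b ^ 3 - 27 * b ^ 2 * c + 54 * a * c ^ 2) * N ^ 2 * Q +
        (b ^ 7 - 18 * a * b ^ 5 * c + 54 * a ^ 2 * b ^ 3 * c ^ 2 + 189 * b ^ 4 * c ^ 2 -
          972 * a * b ^ 2 * c ^ 3 + 729 * a ^ 2 * c ^ 4 + 729 * b * c ^ 4) * N * Q ^ 2 -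
        c * (2 * b ^ 3 - 9 * a * b * c + 27 * c ^ 2) ^ 3 * Q ^ 3 := by
  subst hM hN hG hL hQ' hQ hP he
  ring

/-- The complementary degree-3 covering `φ₂` maps points of the genus-2 curve
`C : d·y² = P(x)·Q(x)` to points of the elliptic curve `E₂`. -/
theorem stmt_2 (K : Type*) [Field K]
    (hchar2 : ringChar K ≠ 2) (hchar3 : ringChar K ≠ 3)
    (a b c d x₀ y₀ : K)
    (P Q N : K[X])
    (hPdef : P = X ^ 3 + C a * X ^ 2 + C b * X + C c)
    (hQdef : Q = C (4 * c) * X ^ 3 + C (b ^ 2) * X ^ 2 + C (2 * b * c) * X + C (c ^ 2))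
    (hNdef : N = (C b * X + C (3 * c)) ^ 2 *
      (C (b ^ 3 - 4 * a * b * c + 9 * c ^ 2) * X + C (c * (b ^ 2 - 3 * a * c))))
    (hC : d * y₀ ^ 2 = P.eval x₀ * Q.eval x₀)
    (hQ : Q.eval x₀ ≠ 0)
    (hbx : b * x₀ + 3 * c ≠ 0)
    (u v : K)
    (hu : u = N.eval x₀ / Q.eval x₀)
    (hv : v = y₀ * ((derivative N).eval x₀ * Q.eval x₀ - N.eval x₀ * (derivative Q).eval x₀) /
      ((b * x₀ + 3 * c) * Q.eval x₀ ^ 2)) :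
    (b ^ 3 - 27 * c ^ 2) * d * v ^ 2 =
      u ^ 3 + (a * b ^ 3 - 27 * b ^ 2 * c + 54 * a * c ^ 2) * u ^ 2 +
        (b ^ 7 - 18 * a * b ^ 5 * c + 54 * a ^ 2 * b ^ 3 * c ^ 2 + 189 * b ^ 4 * c ^ 2 -
          972 * a * b ^ 2 * c ^ 3 + 729 * a ^ 2 * c ^ 4 + 729 * b * c ^ 4) * u -
        c * (2 * b ^ 3 - 9 * a * b * c + 27 * c ^ 2) ^ 3 := by
  obtain ⟨e, he⟩ : ∃ e, e = b ^ 3 - 4 * a * b * c + 9 * c ^ 2 := ⟨_, rfl⟩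
  obtain ⟨L, hL⟩ : ∃ L, L = b * x₀ + 3 * c := ⟨_, rfl⟩
  obtain ⟨G, hG⟩ : ∃ G, G = e * x₀ + c * (b ^ 2 - 3 * a * c) := ⟨_, rfl⟩
  have hP : P.eval x₀ = x₀ ^ 3 + a * x₀ ^ 2 + b * x₀ + c := by simp [hPdef]
  have hQe : Q.eval x₀ = 4 * c * x₀ ^ 3 + b ^ 2 * x₀ ^ 2 + 2 * b * c * x₀ + c ^ 2 := by
    simp [hQdef]
  have hQ' : (derivative Q).eval x₀ = 12 * c * x₀ ^ 2 + 2 * b ^ 2 * x₀ + 2 * b * c := by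
    simp [hQdef, -map_pow, -map_mul]
    ring
  have hN : N.eval x₀ = L ^ 2 * G := by simp [hNdef, hG, hL, he]
  have hN' : (derivative N).eval x₀ = L * (2 * b * G + L * e) := by
    rw [hNdef, ← he, hG, hL]
    simp [derivative_pow, -map_pow, -map_mul, -map_sub]
    ring
  obtain ⟨M, hM⟩ : ∃ M, M = (2 * b * G + L * e) * Q.eval x₀ - L * G * (derivative Q).eval x₀ :=
    ⟨_, rfl⟩
  have key := covering_identity he hP hQe hQ' hL hG hN hM
  have hnum : (derivative N).eval x₀ * Q.eval x₀ - N.eval x₀ * (derivative Q).eval x₀ =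
      L * M := by
    rw [hM, hN', hN]
    ring
  have hvM : v = y₀ * M / Q.eval x₀ ^ 2 := by
    rw [← hL] at hbx hv
    rw [hv, hnum, mul_left_comm, mul_div_mul_left _ _ hbx]
  have hv2 : d * v ^ 2 = P.eval x₀ * M ^ 2 / Q.eval x₀ ^ 3 := by
    calc d * v ^ 2 = d * y₀ ^ 2 * M ^ 2 / Q.eval x₀ ^ 4 := by
          rw [hvM]
          ring
      _ = P.eval x₀ * M ^ 2 / Q.eval x₀ ^ 3 := by
          rw [hC]
          field_simp
  rw [mul_assoc, hv2, hu, ← mul_div_assoc, key]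
  field_simp
end

section
/- Let K be a field with char K ∉ {2,3} and let a, b, c ∈ K with c ≠ 0, Δ₁ := a²b² − 4b³ − 4a³c + 18abc − 27c² ≠ 0 and b³ − 27c² ≠ 0. Consider the Weierstrass curve W over K given by y² = x³ + 2(−ab² + 6a²c − 9bc)x² + Δ₁(b² − 12ac)x + 4cΔ₁² (an integral model of the elliptic curve E₁: (d/Δ₁)y² = x³ + (2(−ab² + 6a²c − 9bc)/Δ₁)x² + ((b² − 12ac)/Δ₁)x + 4c/Δ₁, whose j-invariant is the same). Then W has nonzero discriminant and its j-invariant equals 16(a²b⁴ + 12b⁵ − 126ab³c + 216a²bc² + 405b²c² − 972ac³)³ / ((b³ − 27c²)³ · (a²b² − 4b³ − 4a³c + 18abc − 27c²)²). -/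
/-- The j-invariant of the elliptic curve `E₁` (generic case),
computed on an integral Weierstrass model. -/
theorem stmt_3 (K : Type*) [Field K]
    (hchar2 : ringChar K ≠ 2) (hchar3 : ringChar K ≠ 3)
    (a b c : K) (hc : c ≠ 0)
    (hΔ₁ : a ^ 2 * b ^ 2 - 4 * b ^ 3 - 4 * a ^ 3 * c + 18 * a * b * c - 27 * c ^ 2 ≠ 0)
    (hbc : b ^ 3 - 27 * c ^ 2 ≠ 0)
    (W : WeierstrassCurve K)
    (hW : W = ⟨0, 2 * (-(a * b ^ 2) + 6 * a ^ 2 * c - 9 * b * c), 0,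
      (a ^ 2 * b ^ 2 - 4 * b ^ 3 - 4 * a ^ 3 * c + 18 * a * b * c - 27 * c ^ 2) *
        (b ^ 2 - 12 * a * c),
      4 * c * (a ^ 2 * b ^ 2 - 4 * b ^ 3 - 4 * a ^ 3 * c + 18 * a * b * c - 27 * c ^ 2) ^ 2⟩) :
    W.Δ ≠ 0 ∧ ∃ hE : W.IsElliptic, @WeierstrassCurve.j K _ W hE =
      16 * (a ^ 2 * b ^ 4 + 12 * b ^ 5 - 126 * a * b ^ 3 * c + 216 * a ^ 2 * b * c ^ 2 +
          405 * b ^ 2 * c ^ 2 - 972 * a * c ^ 3) ^ 3 /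
        ((b ^ 3 - 27 * c ^ 2) ^ 3 *
          (a ^ 2 * b ^ 2 - 4 * b ^ 3 - 4 * a ^ 3 * c + 18 * a * b * c - 27 * c ^ 2) ^ 2) := by
  have h2 : (2 : K) ≠ 0 := Ring.two_ne_zero hchar2
  have h256 : (256 : K) ≠ 0 := by
    rw [show (256 : K) = 2 ^ 8 by norm_num]
    exact pow_ne_zero 8 h2
  have hdisc : W.Δ = 256 * ((b ^ 3 - 27 * c ^ 2) ^ 3 *
      (a ^ 2 * b ^ 2 - 4 * b ^ 3 - 4 * a ^ 3 * c + 18 * a * b * c - 27 * c ^ 2) ^ 2) := by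
    subst hW
    simp only [WeierstrassCurve.Δ, WeierstrassCurve.b₂, WeierstrassCurve.b₄,
      WeierstrassCurve.b₆, WeierstrassCurve.b₈]
    ring
  have hc₄ : W.c₄ = 16 * (a ^ 2 * b ^ 4 + 12 * b ^ 5 - 126 * a * b ^ 3 * c +
      216 * a ^ 2 * b * c ^ 2 + 405 * b ^ 2 * c ^ 2 - 972 * a * c ^ 3) := by
    subst hW
    simp only [WeierstrassCurve.c₄, WeierstrassCurve.b₂, WeierstrassCurve.b₄]
    ring
  have hne := mul_ne_zero (pow_ne_zero 3 hbc) (pow_ne_zero 2 hΔ₁)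
  have hΔ : W.Δ ≠ 0 := hdisc ▸ mul_ne_zero h256 hne
  have hE : W.IsElliptic := ⟨hΔ.isUnit⟩
  refine ⟨hΔ, hE, ?_⟩
  rw [WeierstrassCurve.j, Units.val_inv_eq_inv_val, WeierstrassCurve.coe_Δ', hdisc, hc₄,
    inv_mul_eq_div, div_eq_div_iff (mul_ne_zero h256 hne) hne]
  ring
end

section
/- Let K be a field with char K ∉ {2,3} and let a, b, c ∈ K with c ≠ 0, Δ₁ := a²b² − 4b³ − 4a³c + 18abc − 27c² ≠ 0 and b³ − 27c² ≠ 0. Consider the Weierstrass curve W over K given by y² = x³ + (ab³ − 27b²c + 54ac²)x² + (b⁷ − 18ab⁵c + 54a²b³c² + 189b⁴c² − 972ab²c³ + 729a²c⁴ + 729bc⁴)x − c(2b³ − 9abc + 27c²)³ (an integral model of the elliptic curve E₂ complementary to E₁, whose j-invariant is the same). Then W has nonzero discriminant and its j-invariant equals 256(a² − 3b)³ / (a²b² − 4b³ − 4a³c + 18abc − 27c²). -/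
/-- The j-invariant of the complementary elliptic curve `E₂` (generic case),
computed on an integral Weierstrass model. -/
theorem stmt_4 (K : Type*) [Field K]
    (hchar2 : ringChar K ≠ 2) (hchar3 : ringChar K ≠ 3)
    (a b c : K) (hc : c ≠ 0)
    (hΔ₁ : a ^ 2 * b ^ 2 - 4 * b ^ 3 - 4 * a ^ 3 * c + 18 * a * b * c - 27 * c ^ 2 ≠ 0)
    (hbc : b ^ 3 - 27 * c ^ 2 ≠ 0)
    (W : WeierstrassCurve K)
    (hW : W = ⟨0, a * b ^ 3 - 27 * b ^ 2 * c + 54 * a * c ^ 2, 0,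
      b ^ 7 - 18 * a * b ^ 5 * c + 54 * a ^ 2 * b ^ 3 * c ^ 2 + 189 * b ^ 4 * c ^ 2 -
        972 * a * b ^ 2 * c ^ 3 + 729 * a ^ 2 * c ^ 4 + 729 * b * c ^ 4,
      -(c * (2 * b ^ 3 - 9 * a * b * c + 27 * c ^ 2) ^ 3)⟩) :
    W.Δ ≠ 0 ∧ ∃ hE : W.IsElliptic, @WeierstrassCurve.j K _ W hE =
      256 * (a ^ 2 - 3 * b) ^ 3 /
        (a ^ 2 * b ^ 2 - 4 * b ^ 3 - 4 * a ^ 3 * c + 18 * a * b * c - 27 * c ^ 2) := by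
  have h₂ : (2 : K) ≠ 0 := Ring.two_ne_zero hchar2
  have hΔ : W.Δ = 16 * (a ^ 2 * b ^ 2 - 4 * b ^ 3 - 4 * a ^ 3 * c + 18 * a * b * c - 27 * c ^ 2) *
      (b ^ 3 - 27 * c ^ 2) ^ 6 := by
    rw [hW]
    simp only [WeierstrassCurve.Δ, WeierstrassCurve.b₂, WeierstrassCurve.b₄, WeierstrassCurve.b₆,
      WeierstrassCurve.b₈]
    ring
  have hc₄ : W.c₄ = 16 * (a ^ 2 - 3 * b) * (b ^ 3 - 27 * c ^ 2) ^ 2 := by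
    rw [hW]
    simp only [WeierstrassCurve.c₄, WeierstrassCurve.b₂, WeierstrassCurve.b₄]
    ring
  have h₁₆ : (16 : K) ≠ 0 := by
    rw [show (16 : K) = 2 ^ 4 by norm_num]
    exact pow_ne_zero 4 h₂
  have hΔ_ne : W.Δ ≠ 0 := by
    rw [hΔ]
    exact mul_ne_zero (mul_ne_zero h₁₆ hΔ₁) (pow_ne_zero 6 hbc)
  have hE : W.IsElliptic := ⟨hΔ_ne.isUnit⟩
  refine ⟨hΔ_ne, hE, ?_⟩
  rw [WeierstrassCurve.j, Units.val_inv_eq_inv_val, WeierstrassCurve.coe_Δ', inv_mul_eq_div,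
    div_eq_div_iff hΔ_ne hΔ₁, hΔ, hc₄]
  ring
end

section
/- Let K be a field with char K ∉ {2,3}, let b, c, d ∈ K, and set P(X) = (bX + 3c)(9cX² + 2b²X + 3bc), Q(X) = 4cX³ + b²X² + 2bcX + c², and Δ = b³ − 27c². Suppose x₀, y₀ ∈ K satisfy d·y₀² = P(x₀)·Q(x₀) and P(x₀) ≠ 0. Define u = x₀²/P(x₀) and v = y₀·(2P(x₀) − x₀·P′(x₀))/P(x₀)², where P′ is the derivative of P. Then 9bd·v² = 4Δ³·u³ + 12Δ²·u² − 3(5b³ + 108c²)·u + 4. -/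
open Polynomial

/-- In the 'second map special' case, the generic degree-3 covering `φ₁`
maps points of the genus-2 curve `C : d·y² = P(x)·Q(x)` to points of the elliptic curve `E₁`. -/
theorem stmt_5 (K : Type*) [Field K]
    (hchar2 : ringChar K ≠ 2) (hchar3 : ringChar K ≠ 3)
    (b c d x₀ y₀ : K)
    (P Q : K[X])
    (hPdef : P = (C b * X + C (3 * c)) * (C (9 * c) * X ^ 2 + C (2 * b ^ 2) * X + C (3 * b * c)))
    (hQdef : Q = C (4 * c) * X ^ 3 + C (b ^ 2) * X ^ 2 + C (2 * b * c) * X + C (c ^ 2))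
    (hC : d * y₀ ^ 2 = P.eval x₀ * Q.eval x₀)
    (hP : P.eval x₀ ≠ 0)
    (u v : K)
    (hu : u = x₀ ^ 2 / P.eval x₀)
    (hv : v = y₀ * (2 * P.eval x₀ - x₀ * (derivative P).eval x₀) / P.eval x₀ ^ 2) :
    9 * b * d * v ^ 2 =
      4 * (b ^ 3 - 27 * c ^ 2) ^ 3 * u ^ 3 + 12 * (b ^ 3 - 27 * c ^ 2) ^ 2 * u ^ 2 -
        3 * (5 * b ^ 3 + 108 * c ^ 2) * u + 4 := by
  have eval_P : P.eval x₀ = (b * x₀ + 3 * c) * (9 * c * x₀ ^ 2 + 2 * b ^ 2 * x₀ + 3 * b * c) := by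
    simp [hPdef]
  have eval_Q : Q.eval x₀ = 4 * c * x₀ ^ 3 + b ^ 2 * x₀ ^ 2 + 2 * b * c * x₀ + c ^ 2 := by
    simp [hQdef]
  have eval_P' : (derivative P).eval x₀ =
      27 * b * c * x₀ ^ 2 + 2 * (2 * b ^ 3 + 27 * c ^ 2) * x₀ + 9 * b ^ 2 * c := by
    simp only [hPdef, derivative_mul, derivative_add, derivative_C, derivative_X,
      derivative_X_pow, eval_add, eval_mul, eval_C, eval_X, eval_pow, eval_zero, eval_one,
      Nat.cast_ofNat, C_ofNat, eval_ofNat]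
    ring
  generalize P.eval x₀ = p at *
  generalize Q.eval x₀ = q at *
  generalize (derivative P).eval x₀ = p' at *
  have covering : 9 * b * q * (2 * p - x₀ * p') ^ 2 =
      4 * (b ^ 3 - 27 * c ^ 2) ^ 3 * x₀ ^ 6 + 12 * (b ^ 3 - 27 * c ^ 2) ^ 2 * x₀ ^ 4 * p -
        3 * (5 * b ^ 3 + 108 * c ^ 2) * x₀ ^ 2 * p ^ 2 + 4 * p ^ 3 := by
    rw [eval_P, eval_Q, eval_P']
    ring
  calc
    9 * b * d * v ^ 2 = 9 * b * (d * y₀ ^ 2) * (2 * p - x₀ * p') ^ 2 / p ^ 4 := by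
      rw [hv]
      ring
    _ = 9 * b * q * (2 * p - x₀ * p') ^ 2 / p ^ 3 := by
      rw [hC]
      field_simp
    _ = _ := by
      rw [covering, hu]
      field_simp
end

section
/- Let K be a field with char K ∉ {2,3}, let b, c, d ∈ K, and set P(X) = (bX + 3c)(9cX² + 2b²X + 3bc), Q(X) = 4cX³ + b²X² + 2bcX + c², and Δ = b³ − 27c². Suppose x₀, y₀ ∈ K satisfy d·y₀² = P(x₀)·Q(x₀), Q(x₀) ≠ 0 and b·x₀ + 3c ≠ 0. Define u = (b·x₀ + 3c)³/Q(x₀) and v = y₀·(b·x₀ + 3c)·(3b·Q(x₀) − (b·x₀ + 3c)·Q′(x₀))/Q(x₀)², where Q′ is the derivative of Q. Then d·v² = c·u³ + 2Δ·u² − 27cΔ·u. -/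
open Polynomial

/-- In the 'second map special' case, the special degree-3 covering `φ₂`
maps points of the genus-2 curve `C : d·y² = P(x)·Q(x)` to points of the elliptic curve `E₂`. -/
theorem stmt_6 (K : Type*) [Field K]
    (hchar2 : ringChar K ≠ 2) (hchar3 : ringChar K ≠ 3)
    (b c d x₀ y₀ : K)
    (P Q : K[X])
    (hPdef : P = (C b * X + C (3 * c)) * (C (9 * c) * X ^ 2 + C (2 * b ^ 2) * X + C (3 * b * c)))
    (hQdef : Q = C (4 * c) * X ^ 3 + C (b ^ 2) * X ^ 2 + C (2 * b * c) * X + C (c ^ 2))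
    (hC : d * y₀ ^ 2 = P.eval x₀ * Q.eval x₀)
    (hQ : Q.eval x₀ ≠ 0)
    (hbx : b * x₀ + 3 * c ≠ 0)
    (u v : K)
    (hu : u = (b * x₀ + 3 * c) ^ 3 / Q.eval x₀)
    (hv : v = y₀ * (b * x₀ + 3 * c) *
      (3 * b * Q.eval x₀ - (b * x₀ + 3 * c) * (derivative Q).eval x₀) / Q.eval x₀ ^ 2) :
    d * v ^ 2 = c * u ^ 3 + 2 * (b ^ 3 - 27 * c ^ 2) * u ^ 2 -
      27 * c * (b ^ 3 - 27 * c ^ 2) * u := by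
  have hP : P.eval x₀ = (b * x₀ + 3 * c) * (9 * c * x₀ ^ 2 + 2 * b ^ 2 * x₀ + 3 * b * c) := by
    simp [hPdef]
  have hQe : Q.eval x₀ = 4 * c * x₀ ^ 3 + b ^ 2 * x₀ ^ 2 + 2 * b * c * x₀ + c ^ 2 := by
    simp [hQdef]
  have hQ' : (derivative Q).eval x₀ = 12 * c * x₀ ^ 2 + 2 * b ^ 2 * x₀ + 2 * b * c := by
    simp only [hQdef, derivative_add, derivative_C_mul, derivative_X_pow, derivative_X,
      derivative_C, eval_add, eval_mul, eval_C, eval_X, eval_pow, eval_one, eval_zero]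
    push_cast
    ring
  generalize (derivative Q).eval x₀ = q' at *
  generalize Q.eval x₀ = q at *
  rw [hP] at hC
  have key : (9 * c * x₀ ^ 2 + 2 * b ^ 2 * x₀ + 3 * b * c) *
      (3 * b * q - (b * x₀ + 3 * c) * q') ^ 2 =
      c * (b * x₀ + 3 * c) ^ 6 + 2 * (b ^ 3 - 27 * c ^ 2) * (b * x₀ + 3 * c) ^ 3 * q -
        27 * c * (b ^ 3 - 27 * c ^ 2) * q ^ 2 := by
    rw [hQe, hQ']
    ring
  clear hQe hQ'
  rw [hu, hv]
  field_simp
  linear_combination (3 * b * q - (b * x₀ + 3 * c) * q') ^ 2 * hC +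
    (b * x₀ + 3 * c) * q * key
end

section
/- Let K be a field with char K ∉ {2,3} and let b, c ∈ K with b ≠ 0, c ≠ 0 and Δ := b³ − 27c² ≠ 0. Consider the Weierstrass curves over K given by W₁: y² = x³ + 6Δx² − 3Δ(5b³ + 108c²)x + 8Δ³ and W₂: y² = x³ + 2Δx² − 27c²Δx (integral models of the curves E₁: (9bd/(4Δ³))y² = x³ + (3/Δ)x² − (3(5b³ + 108c²)/(4Δ³))x + 1/Δ³ and E₂: (d/c)y² = x³ + (2Δ/c)x² − 27Δx, with the same j-invariants). Then W₁ and W₂ have nonzero discriminants, the j-invariant of W₁ equals 64b³/c², and the j-invariant of W₂ equals 64(4b³ − 27c²)³/(729·b³·c⁴). -/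
/-- The `j`-invariant as a quotient of `c₄ ^ 3` by the discriminant. -/
lemma WeierstrassCurve.exists_isElliptic_j_eq {K : Type*} [Field K] (W : WeierstrassCurve K)
    (hW : W.Δ ≠ 0) : ∃ hE : W.IsElliptic, @WeierstrassCurve.j K _ W hE = W.c₄ ^ 3 / W.Δ := by
  have hE : W.IsElliptic := ⟨hW.isUnit⟩
  refine ⟨hE, ?_⟩
  rw [WeierstrassCurve.j, Units.val_inv_eq_inv_val, WeierstrassCurve.coe_Δ', div_eq_inv_mul]

lemma natCast_prime_ne_zero_of_ringChar_ne {K : Type*} [Field K] {p : ℕ} (hp : p.Prime)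
    (h : ringChar K ≠ p) : (p : K) ≠ 0 := fun h0 =>
  ((Nat.dvd_prime hp).1 (ringChar.dvd h0)).elim CharP.ringChar_ne_one h


/-- The j-invariants of the two elliptic curves in the
'second map special' case, computed on integral Weierstrass models. -/
theorem stmt_7 (K : Type*) [Field K]
    (hchar2 : ringChar K ≠ 2) (hchar3 : ringChar K ≠ 3)
    (b c : K) (hb : b ≠ 0) (hc : c ≠ 0) (hΔ : b ^ 3 - 27 * c ^ 2 ≠ 0)
    (W₁ W₂ : WeierstrassCurve K)
    (hW₁ : W₁ = ⟨0, 6 * (b ^ 3 - 27 * c ^ 2), 0,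
      -(3 * (b ^ 3 - 27 * c ^ 2) * (5 * b ^ 3 + 108 * c ^ 2)),
      8 * (b ^ 3 - 27 * c ^ 2) ^ 3⟩)
    (hW₂ : W₂ = ⟨0, 2 * (b ^ 3 - 27 * c ^ 2), 0,
      -(27 * c ^ 2 * (b ^ 3 - 27 * c ^ 2)), 0⟩) :
    W₁.Δ ≠ 0 ∧ W₂.Δ ≠ 0 ∧
      (∃ hE₁ : W₁.IsElliptic, @WeierstrassCurve.j K _ W₁ hE₁ = 64 * b ^ 3 / c ^ 2) ∧
      (∃ hE₂ : W₂.IsElliptic, @WeierstrassCurve.j K _ W₂ hE₂ =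
        64 * (4 * b ^ 3 - 27 * c ^ 2) ^ 3 / (729 * b ^ 3 * c ^ 4)) := by
  have h2 : (2 : K) ≠ 0 := mod_cast natCast_prime_ne_zero_of_ringChar_ne Nat.prime_two hchar2
  have h3 : (3 : K) ≠ 0 := mod_cast natCast_prime_ne_zero_of_ringChar_ne Nat.prime_three hchar3
  have hΔ₁ : W₁.Δ = 2 ^ 6 * 3 ^ 12 * (b ^ 3 - 27 * c ^ 2) ^ 3 * b ^ 6 * c ^ 2 := by
    simp only [hW₁, WeierstrassCurve.Δ, WeierstrassCurve.b₂, WeierstrassCurve.b₄,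
      WeierstrassCurve.b₆, WeierstrassCurve.b₈]
    ring
  have hΔ₂ : W₂.Δ = 2 ^ 6 * 3 ^ 6 * (b ^ 3 - 27 * c ^ 2) ^ 3 * b ^ 3 * c ^ 4 := by
    simp only [hW₂, WeierstrassCurve.Δ, WeierstrassCurve.b₂, WeierstrassCurve.b₄,
      WeierstrassCurve.b₆, WeierstrassCurve.b₈]
    ring
  have hc₁ : W₁.c₄ = 2 ^ 4 * 3 ^ 4 * (b ^ 3 - 27 * c ^ 2) * b ^ 3 := by
    simp only [hW₁, WeierstrassCurve.c₄, WeierstrassCurve.b₂, WeierstrassCurve.b₄]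
    ring
  have hc₂ : W₂.c₄ = 2 ^ 4 * (b ^ 3 - 27 * c ^ 2) * (4 * b ^ 3 - 27 * c ^ 2) := by
    simp only [hW₂, WeierstrassCurve.c₄, WeierstrassCurve.b₂, WeierstrassCurve.b₄]
    ring
  have hne₁ : W₁.Δ ≠ 0 := by simp [hΔ₁, h2, h3, hΔ, hb, hc]
  have hne₂ : W₂.Δ ≠ 0 := by simp [hΔ₂, h2, h3, hΔ, hb, hc]
  obtain ⟨hE₁, hj₁⟩ := W₁.exists_isElliptic_j_eq hne₁
  obtain ⟨hE₂, hj₂⟩ := W₂.exists_isElliptic_j_eq hne₂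
  refine ⟨hne₁, hne₂, ⟨hE₁, ?_⟩, hE₂, ?_⟩
  · rw [hj₁, div_eq_div_iff hne₁ (by simp [hc]), hc₁, hΔ₁]
    ring
  · rw [hj₂, show (729 : K) = 3 ^ 6 by norm_num,
      div_eq_div_iff hne₂ (by simp [h3, hb, hc]), hc₂, hΔ₂]
    ring
end

section
/- Let K be a field with char K ∉ {2,3} and define F(X,Y) = X³ − 1296X² − 729XY + 559872X − 80621568 ∈ K[X,Y]. Then for all a, b ∈ K with b ≠ 0, a² − 3b ≠ 0 and a² − 4b ≠ 0, one has F(256(a² − 3b)³/(b²(a² − 4b)), 16(16a⁶ − 144a⁴b + 405a²b² − 324b³)³/(729·b⁴·(a² − 3b)³·(a² − 4b)²)) = 0. -/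
/-- The pair of j-invariants `(j(E₂), j(E₁))` in the 'first map special'
parametrization lies on the curve `F(X,Y) = 0`. -/
theorem stmt_9 (K : Type*) [Field K]
    (hchar2 : ringChar K ≠ 2) (hchar3 : ringChar K ≠ 3)
    (F : K → K → K)
    (hF : ∀ X Y : K, F X Y = X ^ 3 - 1296 * X ^ 2 - 729 * X * Y + 559872 * X - 80621568) :
    ∀ a b : K, b ≠ 0 → a ^ 2 - 3 * b ≠ 0 → a ^ 2 - 4 * b ≠ 0 →
      F (256 * (a ^ 2 - 3 * b) ^ 3 / (b ^ 2 * (a ^ 2 - 4 * b)))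
        (16 * (16 * a ^ 6 - 144 * a ^ 4 * b + 405 * a ^ 2 * b ^ 2 - 324 * b ^ 3) ^ 3 /
          (729 * b ^ 4 * (a ^ 2 - 3 * b) ^ 3 * (a ^ 2 - 4 * b) ^ 2)) = 0 := by
  intro a b hb hc hd
  have h3 : (3 : K) ≠ 0 := by
    intro h
    have hdvd : ringChar K ∣ 3 := ringChar.dvd (by exact_mod_cast h)
    rcases (Nat.dvd_prime Nat.prime_three).mp hdvd with h1 | h1
    · have h10 : ((1 : ℕ) : K) = 0 := (ringChar.spec K 1).mpr (by rw [h1])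
      exact one_ne_zero (by exact_mod_cast h10)
    · exact hchar3 h1
  have h729 : (729 : K) ≠ 0 := by
    have : (729 : K) = 3 ^ 6 := by norm_num
    rw [this]
    exact pow_ne_zero 6 h3
  have hcube : ∀ X Y : K, F X Y = (X - 432) ^ 3 - 729 * X * Y := by
    intro X Y
    rw [hF]
    ring
  rw [hcube]
  have hX : 256 * (a ^ 2 - 3 * b) ^ 3 / (b ^ 2 * (a ^ 2 - 4 * b)) - 432 =
      16 * (16 * a ^ 6 - 144 * a ^ 4 * b + 405 * a ^ 2 * b ^ 2 - 324 * b ^ 3) /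
        (b ^ 2 * (a ^ 2 - 4 * b)) := by
    have hbd := mul_ne_zero (pow_ne_zero 2 hb) hd
    rw [div_sub' hbd, div_left_inj' hbd]
    ring
  rw [hX]
  generalize 16 * a ^ 6 - 144 * a ^ 4 * b + 405 * a ^ 2 * b ^ 2 - 324 * b ^ 3 = P
  generalize a ^ 2 - 3 * b = c at *
  generalize a ^ 2 - 4 * b = d at *
  field_simp
  ring
end

section
/- Let K be a field with char K ∉ {2,3} and let a, b ∈ K. In K[x], the remainder upon division of 3(a² − 4b)²x² − 4ab(a² − 4b)x − 16b²(a² − 3b) by the monic polynomial x² + ax + b equals −a(3a² − 8b)(a² − 4b)·x − a²b(3a² − 8b). Moreover, if b ≠ 0 and a² − 4b ≠ 0, then this remainder is the zero polynomial if and only if a = 0 or 8b = 3a². -/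
open Polynomial

/-- The remainder of the division arising in the 'both maps special' case,
and the dichotomy `a = 0` or `8b = 3a²` for its vanishing. -/
theorem stmt_10 (K : Type*) [Field K]
    (hchar2 : ringChar K ≠ 2) (hchar3 : ringChar K ≠ 3)
    (a b : K)
    (f g r : K[X])
    (hf : f = C (3 * (a ^ 2 - 4 * b) ^ 2) * X ^ 2 - C (4 * a * b * (a ^ 2 - 4 * b)) * X -
      C (16 * b ^ 2 * (a ^ 2 - 3 * b)))
    (hg : g = X ^ 2 + C a * X + C b)
    (hr : r = C (-(a * (3 * a ^ 2 - 8 * b) * (a ^ 2 - 4 * b))) * X +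
      C (-(a ^ 2 * b * (3 * a ^ 2 - 8 * b)))) :
    f %ₘ g = r ∧ (b ≠ 0 → a ^ 2 - 4 * b ≠ 0 → (r = 0 ↔ a = 0 ∨ 8 * b = 3 * a ^ 2)) := by
  subst hf hg hr
  refine ⟨?_, fun hb hD => ⟨fun h => ?_, fun h => ?_⟩⟩
  · have hdeg : (X ^ 2 + C a * X + C b : K[X]).degree = 2 := by
      simpa using degree_quadratic (a := (1 : K)) (b := a) (c := b) one_ne_zero
    have hmonic : (X ^ 2 + C a * X + C b : K[X]).Monic := by
      simpa [Monic] using leadingCoeff_quadratic (a := (1 : K)) (b := a) (c := b) one_ne_zero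
    refine (div_modByMonic_unique (C (3 * (a ^ 2 - 4 * b) ^ 2)) _ hmonic ⟨?_, ?_⟩).2
    · simp only [map_mul, map_sub, map_neg, map_pow, map_ofNat]
      ring
    · rw [hdeg]
      exact degree_linear_lt
  · have h0 : a ^ 2 * b * (3 * a ^ 2 - 8 * b) = 0 := by
      simpa using congrArg (eval 0) h
    rcases mul_eq_zero.mp h0 with h1 | h1
    · exact Or.inl (pow_eq_zero_iff two_ne_zero |>.mp ((mul_eq_zero.mp h1).resolve_right hb))
    · exact Or.inr (sub_eq_zero.mp h1).symm
  · rcases h with rfl | h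
    · simp
    · simp [h]
end

section
/- Let K be a field with char K ∉ {2,3} and let t ∈ K with t ≠ 0. Suppose x, y, z ∈ K satisfy x³ + y³ + z³ − ((1 + 2t³)/t²)·xyz = 0. Define f₁ = x(−2t²y² − t²xy + t²x² − yz + 2t³xz + tz²), f₂ = y(−2t²x² − t²xy + t²y² − xz + 2t³yz + tz²), and f₃ = tz(x + y + tz)(x + y − 2tz). Then f₁³ + f₂³ + f₃³ + ((1 − 4t³)/t)·f₁f₂f₃ = 0. -/
/-- The explicit 2-isogeny `γ` maps points of the Hesse curve `E_a`
(with `3a = −(1+2t³)/t²`) to points of the Hesse curve `E_b` (with `3b = (1−4t³)/t`). -/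
theorem stmt_12 (K : Type*) [Field K]
    (hchar2 : ringChar K ≠ 2) (hchar3 : ringChar K ≠ 3)
    (t : K) (ht : t ≠ 0)
    (x y z : K)
    (hE : x ^ 3 + y ^ 3 + z ^ 3 - (1 + 2 * t ^ 3) / t ^ 2 * (x * y * z) = 0)
    (f₁ f₂ f₃ : K)
    (hf₁ : f₁ = x * (-(2 * t ^ 2 * y ^ 2) - t ^ 2 * x * y + t ^ 2 * x ^ 2 - y * z +
      2 * t ^ 3 * x * z + t * z ^ 2))
    (hf₂ : f₂ = y * (-(2 * t ^ 2 * x ^ 2) - t ^ 2 * x * y + t ^ 2 * y ^ 2 - x * z +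
      2 * t ^ 3 * y * z + t * z ^ 2))
    (hf₃ : f₃ = t * z * (x + y + t * z) * (x + y - 2 * t * z)) :
    f₁ ^ 3 + f₂ ^ 3 + f₃ ^ 3 + (1 - 4 * t ^ 3) / t * (f₁ * f₂ * f₃) = 0 := by
  have hE' : t ^ 2 * (x ^ 3 + y ^ 3 + z ^ 3) - (1 + 2 * t ^ 3) * (x * y * z) = 0 := by
    field_simp at hE
    linear_combination hE
  have h : t * (f₁ ^ 3 + f₂ ^ 3 + f₃ ^ 3) + (1 - 4 * t ^ 3) * (f₁ * f₂ * f₃) = 0 := by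
    subst hf₁ hf₂ hf₃
    linear_combination (t *
      (t ^ 4 * x ^ 6 - 3 * t ^ 4 * x ^ 5 * y + 6 * t ^ 5 * x ^ 5 * z - 3 * t ^ 4 * x ^ 4 * y ^ 2
        - 2 * t ^ 5 * x ^ 4 * y * z - 4 * t ^ 2 * x ^ 4 * y * z + 12 * t ^ 6 * x ^ 4 * z ^ 2 + 3 * t ^ 3 * x ^ 4 * z ^ 2
        + 2 * t ^ 4 * x ^ 3 * y ^ 3 - 12 * t ^ 5 * x ^ 3 * y ^ 2 * z + 8 * t ^ 6 * x ^ 3 * y * z ^ 2 - 10 * t ^ 3 * x ^ 3 * y * z ^ 2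
        - x ^ 3 * y * z ^ 2 + 8 * t ^ 7 * x ^ 3 * z ^ 3 + 11 * t ^ 4 * x ^ 3 * z ^ 3 + t * x ^ 3 * z ^ 3
        - 3 * t ^ 4 * x ^ 2 * y ^ 4 - 12 * t ^ 5 * x ^ 2 * y ^ 3 * z - 18 * t ^ 3 * x ^ 2 * y ^ 2 * z ^ 2 - 8 * t ^ 7 * x ^ 2 * y * z ^ 3
        + 13 * t ^ 4 * x ^ 2 * y * z ^ 3 + t * x ^ 2 * y * z ^ 3 + 6 * t ^ 5 * x ^ 2 * z ^ 4 - 3 * t ^ 4 * x * y ^ 5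
        - 2 * t ^ 5 * x * y ^ 4 * z - 4 * t ^ 2 * x * y ^ 4 * z + 8 * t ^ 6 * x * y ^ 3 * z ^ 2 - 10 * t ^ 3 * x * y ^ 3 * z ^ 2
        - x * y ^ 3 * z ^ 2 - 8 * t ^ 7 * x * y ^ 2 * z ^ 3 + 13 * t ^ 4 * x * y ^ 2 * z ^ 3 + t * x * y ^ 2 * z ^ 3
        - 16 * t ^ 8 * x * y * z ^ 4 + 12 * t ^ 5 * x * y * z ^ 4 - 2 * t ^ 2 * x * y * z ^ 4 - 12 * t ^ 6 * x * z ^ 5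
        + t ^ 4 * y ^ 6 + 6 * t ^ 5 * y ^ 5 * z + 12 * t ^ 6 * y ^ 4 * z ^ 2 + 3 * t ^ 3 * y ^ 4 * z ^ 2
        + 8 * t ^ 7 * y ^ 3 * z ^ 3 + 11 * t ^ 4 * y ^ 3 * z ^ 3 + t * y ^ 3 * z ^ 3 + 6 * t ^ 5 * y ^ 2 * z ^ 4
        - 12 * t ^ 6 * y * z ^ 5 - 8 * t ^ 7 * z ^ 6)) * hE'
  field_simp
  linear_combination h
end

section
/- Let K be a field with char K ∉ {2,3} containing ω with 1 + ω + ω² = 0, and let t ∈ K. Suppose x, y, z ∈ K satisfy −y²z + x³ − 3t(t³ − 8)xz² − 2(t⁶ + 20t³ − 8)z³ = 0. Define X = 3tx − (1 + 2ω)y + 3(t³ + 4)z, Y = 3tx + (1 + 2ω)y + 3(t³ + 4)z, and Z = 6(x − 3t²z). Then X³ + Y³ + Z³ + 3t·XYZ = 0. -/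
/-- The explicit linear change of coordinates maps points of the
Weierstrass model `−y²z + x³ − 3t(t³−8)xz² − 2(t⁶+20t³−8)z³ = 0` to points of the
Hesse model `X³ + Y³ + Z³ + 3t·XYZ = 0`. -/
theorem stmt_15 (K : Type*) [Field K]
    (hchar2 : ringChar K ≠ 2) (hchar3 : ringChar K ≠ 3)
    (ω : K) (hω : 1 + ω + ω ^ 2 = 0)
    (t x y z : K)
    (hW : -(y ^ 2 * z) + x ^ 3 - 3 * t * (t ^ 3 - 8) * x * z ^ 2 -
      2 * (t ^ 6 + 20 * t ^ 3 - 8) * z ^ 3 = 0)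
    (X Y Z : K)
    (hX : X = 3 * t * x - (1 + 2 * ω) * y + 3 * (t ^ 3 + 4) * z)
    (hY : Y = 3 * t * x + (1 + 2 * ω) * y + 3 * (t ^ 3 + 4) * z)
    (hZ : Z = 6 * (x - 3 * t ^ 2 * z)) :
    X ^ 3 + Y ^ 3 + Z ^ 3 + 3 * t * (X * Y * Z) = 0 := by
  subst hX hY hZ
  linear_combination 216 * (t ^ 3 + 1) * hW + 288 * (t ^ 3 + 1) * z * y ^ 2 * hω
end

section
/- Let K be a field with char K ∉ {2,3} and let a ∈ K with a ≠ −1 and a³ ≠ −1. Set b = (2 − a)/(1 + a). Then b³ ≠ −1 and −27·a³·(a³ − 8)³/(a³ + 1)³ = −27·b³·(b³ − 8)³/(b³ + 1)³. -/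
theorem three_ne_zero_of_ringChar_ne_three {K : Type*} [Field K] (h : ringChar K ≠ 3) :
    (3 : K) ≠ 0 := by
  intro h3
  have hdvd : ringChar K ∣ 3 := ringChar.dvd (by exact_mod_cast h3)
  rcases (Nat.dvd_prime Nat.prime_three).mp hdvd with h1 | h1
  · exact CharP.ringChar_ne_one h1
  · exact h h1

/-- The Hesse parameters `a` and `(2 − a)/(1 + a)` define elliptic curves
with the same j-invariant. -/
theorem stmt_17 (K : Type*) [Field K]
    (hchar2 : ringChar K ≠ 2) (hchar3 : ringChar K ≠ 3)
    (a : K) (ha : a ≠ -1) (ha3 : a ^ 3 ≠ -1)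
    (b : K) (hb : b = (2 - a) / (1 + a)) :
    b ^ 3 ≠ -1 ∧
      -(27 * a ^ 3 * (a ^ 3 - 8) ^ 3) / (a ^ 3 + 1) ^ 3 =
        -(27 * b ^ 3 * (b ^ 3 - 8) ^ 3) / (b ^ 3 + 1) ^ 3 := by
  have h3 : (3 : K) ≠ 0 := three_ne_zero_of_ringChar_ne_three hchar3
  have h9 : (9 : K) ≠ 0 := by
    rw [show (9 : K) = 3 * 3 by norm_num]
    exact mul_ne_zero h3 h3
  have h1 : 1 + a ≠ 0 := fun h => ha (by linear_combination h)
  have hq : a ^ 2 - a + 1 ≠ 0 := fun h => ha3 (by linear_combination (a + 1) * h)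
  have hadd : b ^ 3 + 1 = 9 * (a ^ 2 - a + 1) / (1 + a) ^ 3 := by
    rw [hb]
    field_simp
    ring
  have hsub : b ^ 3 - 8 = -(9 * a * (a ^ 2 + 2 * a + 4)) / (1 + a) ^ 3 := by
    rw [hb]
    field_simp
    ring
  have hfac : a ^ 3 + 1 = (1 + a) * (a ^ 2 - a + 1) := by ring
  refine ⟨fun h => ?_, ?_⟩
  · have hne : 9 * (a ^ 2 - a + 1) / (1 + a) ^ 3 ≠ 0 :=
      div_ne_zero (mul_ne_zero h9 hq) (pow_ne_zero 3 h1)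
    exact hne (by rw [← hadd, h, neg_add_cancel])
  · rw [hadd, hsub, hfac, hb]
    field_simp
    ring
end

section
/- Let K be a field containing ω with 1 + ω + ω² = 0. Then for all t₁, t₂, t₃ ∈ K: (t₁² + t₂² + t₃² + t₁t₂ + t₁t₃ + t₂t₃)² − 12·t₁t₂t₃·(t₁ + t₂ + t₃) = (t₁² + ω·t₂² + ω²·t₃² − 2ω²·t₁t₂ − 2ω·t₁t₃ − 2·t₂t₃)·(t₁² + ω²·t₂² + ω·t₃² − 2ω·t₁t₂ − 2ω²·t₁t₃ − 2·t₂t₃). -/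
/-- The factorization identity over a field containing a primitive cube
root of unity, used in the proof that curves with rational 3-torsion are twists of Hesse
pencil curves. -/
theorem stmt_18 (K : Type*) [Field K]
    (ω : K) (hω : 1 + ω + ω ^ 2 = 0)
    (t₁ t₂ t₃ : K) :
    (t₁ ^ 2 + t₂ ^ 2 + t₃ ^ 2 + t₁ * t₂ + t₁ * t₃ + t₂ * t₃) ^ 2 -
        12 * (t₁ * t₂ * t₃) * (t₁ + t₂ + t₃) =
      (t₁ ^ 2 + ω * t₂ ^ 2 + ω ^ 2 * t₃ ^ 2 - 2 * ω ^ 2 * (t₁ * t₂) - 2 * ω * (t₁ * t₃) -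
          2 * (t₂ * t₃)) *
        (t₁ ^ 2 + ω ^ 2 * t₂ ^ 2 + ω * t₃ ^ 2 - 2 * ω * (t₁ * t₂) - 2 * ω ^ 2 * (t₁ * t₃) -
          2 * (t₂ * t₃)) := by
  grind
end

section
/- Let K be a field with char K ∉ {2,3} and let a ∈ K. Suppose (x₁, y₁, z₁) and (x₂, y₂, z₂) in K³ both satisfy the Hesse equation, i.e. x₁³ + y₁³ + z₁³ + 3a·x₁y₁z₁ = 0 and x₂³ + y₂³ + z₂³ + 3a·x₂y₂z₂ = 0. Define X = y₁²x₂z₂ − y₂²x₁z₁, Y = x₁²y₂z₂ − x₂²y₁z₁, and Z = z₁²x₂y₂ − z₂²x₁y₁. Then X³ + Y³ + Z³ + 3a·XYZ = 0. -/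
/-- The Hesse pencil addition formula produces a point satisfying the
Hesse equation. -/
theorem stmt_19 (K : Type*) [Field K]
    (hchar2 : ringChar K ≠ 2) (hchar3 : ringChar K ≠ 3)
    (a : K) (x₁ y₁ z₁ x₂ y₂ z₂ : K)
    (h₁ : x₁ ^ 3 + y₁ ^ 3 + z₁ ^ 3 + 3 * a * (x₁ * y₁ * z₁) = 0)
    (h₂ : x₂ ^ 3 + y₂ ^ 3 + z₂ ^ 3 + 3 * a * (x₂ * y₂ * z₂) = 0)
    (X Y Z : K)
    (hX : X = y₁ ^ 2 * x₂ * z₂ - y₂ ^ 2 * x₁ * z₁)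
    (hY : Y = x₁ ^ 2 * y₂ * z₂ - x₂ ^ 2 * y₁ * z₁)
    (hZ : Z = z₁ ^ 2 * x₂ * y₂ - z₂ ^ 2 * x₁ * y₁) :
    X ^ 3 + Y ^ 3 + Z ^ 3 + 3 * a * (X * Y * Z) = 0 := by
  subst hX hY hZ
  linear_combination
    (x₂ ^ 3 * y₂ ^ 3 * z₁ ^ 3 + y₂ ^ 3 * z₂ ^ 3 * x₁ ^ 3 + z₂ ^ 3 * x₂ ^ 3 * y₁ ^ 3
      - 3 * (x₁ * y₁ * z₁) * (x₂ * y₂ * z₂) ^ 2) * h₁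
    - (x₁ ^ 3 * y₁ ^ 3 * z₂ ^ 3 + y₁ ^ 3 * z₁ ^ 3 * x₂ ^ 3 + z₁ ^ 3 * x₁ ^ 3 * y₂ ^ 3
      - 3 * (x₁ * y₁ * z₁) ^ 2 * (x₂ * y₂ * z₂)) * h₂
end
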